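/- Let g = g₀ ⊕ g₁ be a non-degenerate filiform Lie superalgebra over ℂ with dim g₀ = 6 and dim g₁ = 3. If g is naturally graded, then g is isomorphic to the Lie superalgebra with basis {X₀,X₁,X₂,X₃,X₄,X₅,Y₁,Y₂,Y₃} and law [X₀,X_i] = X_{i+1} for 1 ≤ i ≤ 4, [X₀,Y_j] = Y_{j+1} for 1 ≤ j ≤ 2, (Y₁,Y₁) = 3X₂, (Y₁,Y₂) = (3/2)X₃, (Y₁,Y₃) = (1/2)X₄, (Y₂,Y₂) = X₄, (Y₂,Y₃) = (1/2)X₅. In particular no such superalgebra has even part isomorphic to the naturally graded filiform Lie algebra Q₅ (the algebra with [X₀,X_i] = X_{i+1} for 1 ≤ i ≤ 4 and [X_i,X_{5−i}] = (−1)^i X₅ for 1 ≤ i ≤ 4). -/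

import Mathlib

/-- The sign `(-1)^(i·j)` for parities `i j : ZMod 2`, as a complex scalar. -/
def ssign (i j : ZMod 2) : ℂ := if i = 1 ∧ j = 1 then -1 else 1

/-- A (complex) Lie superalgebra structure on the vector space `V`: a ℤ₂-grading
`g` whose parts are complementary, together with an even bilinear bracket which is
super skew-symmetric and satisfies the super Jacobi identity on homogeneous elements. -/
structure LieSuperAlg (V : Type*) [AddCommGroup V] [Module ℂ V] where
  g : ZMod 2 → Submodule ℂ V
  bk : V →ₗ[ℂ] V →ₗ[ℂ] V
  compl : IsCompl (g 0) (g 1)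
  grading : ∀ i j : ZMod 2, ∀ x ∈ g i, ∀ y ∈ g j, bk x y ∈ g (i + j)
  skew : ∀ i j : ZMod 2, ∀ x ∈ g i, ∀ y ∈ g j, bk x y = -(ssign i j • bk y x)
  jacobi : ∀ i j k : ZMod 2, ∀ x ∈ g i, ∀ y ∈ g j, ∀ z ∈ g k,
    ssign k i • bk x (bk y z) + ssign i j • bk y (bk z x) + ssign j k • bk z (bk x y) = 0

namespace LieSuperAlg

variable {V : Type*} [AddCommGroup V] [Module ℂ V]

/-- The descending sequences `C⁰(g_i) = g_i`, `C^{k+1}(g_i) = [g₀, C^k(g_i)]`. -/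
def C (A : LieSuperAlg V) (i : ZMod 2) : ℕ → Submodule ℂ V
  | 0 => A.g i
  | k + 1 => Submodule.span ℂ {z | ∃ x ∈ A.g 0, ∃ y ∈ C A i k, z = A.bk x y}

/-- The descending central sequence of the whole superalgebra. -/
def DC (A : LieSuperAlg V) : ℕ → Submodule ℂ V
  | 0 => ⊤
  | k + 1 => Submodule.span ℂ {z | ∃ x ∈ DC A k, ∃ y : V, z = A.bk x y}

/-- Nilpotency: the descending central sequence reaches zero. -/
def IsNilpotent (A : LieSuperAlg V) : Prop := ∃ k, A.DC k = ⊥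

/-- `A` is filiform with parameters `(n, m)`: it is nilpotent, `dim g₀ = n + 1`,
`dim g₁ = m`, and the super-nilindex is `(n, m)` (the maximal one). -/
def IsFiliform (A : LieSuperAlg V) (n m : ℕ) : Prop :=
  A.IsNilpotent ∧ Module.finrank ℂ (A.g 0) = n + 1 ∧ Module.finrank ℂ (A.g 1) = m ∧
    A.C 0 (n - 1) ≠ ⊥ ∧ A.C 1 (m - 1) ≠ ⊥ ∧ A.C 0 n = ⊥ ∧ A.C 1 m = ⊥

/-- Non-degeneracy: the bracket does not vanish identically on `g₁ × g₁`. -/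
def NonDegenerate (A : LieSuperAlg V) : Prop :=
  ∃ x ∈ A.g 1, ∃ y ∈ A.g 1, A.bk x y ≠ 0

/-- `A` is naturally graded: there are subspaces `W a i` (`i ≥ 1`, parity `a`), splitting
the filtrations `C` (so that `W a i ≅ C^{i-1}(g_a)/C^i(g_a)` and `g ≅ gr(g)` in the
natural way) and compatible with the bracket (so `gr(g)` is a graded Lie superalgebra,
`[gⁱ, gʲ] ⊆ g^{i+j}`).  For finite-dimensional nilpotent superalgebras this is
equivalent to the textbook definition `g ≅ gr(g)` with `gr(g)` graded. -/
def NaturallyGraded (A : LieSuperAlg V) : Prop :=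
  ∃ W : ZMod 2 → ℕ → Submodule ℂ V,
    (∀ a, W a 0 = ⊥) ∧
    (∀ a k, A.C a k = W a (k + 1) ⊔ A.C a (k + 1)) ∧
    (∀ a k, W a (k + 1) ⊓ A.C a (k + 1) = ⊥) ∧
    (∀ a b : ZMod 2, ∀ i j : ℕ, ∀ x ∈ W a i, ∀ y ∈ W b j, A.bk x y ∈ W (a + b) (i + j))

/-- `X 0, …, X n` and `Y 1, …, Y m` form an adapted basis of the superalgebra:
the `X i` are even, the `Y j` are odd, and together they form a basis of `V`. -/
def IsAdaptedBasis (A : LieSuperAlg V) (n m : ℕ) (X Y : ℕ → V) : Prop :=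
  (∀ i, i ≤ n → X i ∈ A.g 0) ∧ (∀ j, 1 ≤ j → j ≤ m → Y j ∈ A.g 1) ∧
  LinearIndependent ℂ
    (Sum.elim (fun i : Fin (n + 1) => X i.val) (fun j : Fin m => Y (j.val + 1))) ∧
  Submodule.span ℂ
    (Set.range (Sum.elim (fun i : Fin (n + 1) => X i.val) (fun j : Fin m => Y (j.val + 1)))) = ⊤

end LieSuperAlg

/-- The even part of `A` is isomorphic to the naturally graded filiform Lie algebra
`Q₅`: there is a basis `Z 0, …, Z 5` of `g₀` with `[Z₀,Z_i] = Z_{i+1}` (`1 ≤ i ≤ 4`)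
and `[Z_i,Z_{5-i}] = (-1)^i Z₅` (`1 ≤ i ≤ 4`), all other products being zero. -/
def EvenPartIsQ5 {V : Type*} [AddCommGroup V] [Module ℂ V] (A : LieSuperAlg V) : Prop :=
  ∃ Z : ℕ → V,
    (∀ i, i ≤ 5 → Z i ∈ A.g 0) ∧
    LinearIndependent ℂ (fun i : Fin 6 => Z i.val) ∧
    Submodule.span ℂ (Set.range fun i : Fin 6 => Z i.val) = A.g 0 ∧
    (∀ i j : ℕ, i ≤ 5 → j ≤ 5 → A.bk (Z i) (Z j) =
      if i = 0 ∧ 1 ≤ j ∧ j ≤ 4 then Z (j + 1)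
      else if j = 0 ∧ 1 ≤ i ∧ i ≤ 4 then -Z (i + 1)
      else if i + j = 5 ∧ 1 ≤ i ∧ i ≤ 4 then ((-1 : ℂ) ^ i) • Z 5
      else 0)

namespace LieSuperAlg

variable {V : Type*} [AddCommGroup V] [Module ℂ V] {A : LieSuperAlg V}

section DescendingSequences

lemma bk_mem_C {a : ZMod 2} {k : ℕ} {x y : V} (hx : x ∈ A.g 0) (hy : y ∈ A.C a k) :
    A.bk x y ∈ A.C a (k + 1) :=
  Submodule.subset_span ⟨x, hx, y, hy, rfl⟩

lemma C_le_g (A : LieSuperAlg V) (a : ZMod 2) (k : ℕ) : A.C a k ≤ A.g a := by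
  induction k with
  | zero => exact le_rfl
  | succ k ih =>
    refine Submodule.span_le.2 ?_
    rintro _ ⟨x, hx, y, hy, rfl⟩
    simpa using A.grading 0 a x hx y (ih hy)

lemma C_succ_le (A : LieSuperAlg V) (a : ZMod 2) (k : ℕ) : A.C a (k + 1) ≤ A.C a k := by
  induction k with
  | zero => exact A.C_le_g a 1
  | succ k ih =>
    refine Submodule.span_le.2 ?_
    rintro _ ⟨x, hx, y, hy, rfl⟩
    exact bk_mem_C hx (ih hy)

lemma C_antitone (A : LieSuperAlg V) (a : ZMod 2) : Antitone (A.C a) :=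
  antitone_nat_of_succ_le (A.C_succ_le a)

lemma C_eq_bot_of_le_succ {a : ZMod 2} {k n : ℕ} (h : A.C a k ≤ A.C a (k + 1))
    (hn : A.C a n = ⊥) : A.C a k = ⊥ := by
  have key : ∀ j, A.C a (k + j) ≤ A.C a (k + j + 1) := by
    intro j
    induction j with
    | zero => exact h
    | succ j ih =>
      refine Submodule.span_le.2 ?_
      rintro _ ⟨x, hx, y, hy, rfl⟩
      exact bk_mem_C hx (ih hy)
  have key' : ∀ j, A.C a k ≤ A.C a (k + j) := by
    intro j
    induction j with
    | zero => exact le_rfl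
    | succ j ih => exact ih.trans (key j)
  exact le_bot_iff.1 (((key' n).trans (A.C_antitone a (Nat.le_add_left n k))).trans hn.le)

lemma leibniz {i j : ZMod 2} {x u v : V} (hx : x ∈ A.g 0) (hu : u ∈ A.g i) (hv : v ∈ A.g j) :
    A.bk x (A.bk u v) = A.bk (A.bk x u) v + A.bk u (A.bk x v) := by
  have hJ := A.jacobi 0 i j x hx u hu v hv
  have hxu : A.bk x u ∈ A.g i := by simpa using A.grading 0 i x hx u hu
  have h1 := A.skew j 0 v hv x hx
  have h2 := A.skew j i v hv _ hxu
  have hs : ssign i j * ssign j i = 1 := by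
    unfold ssign
    by_cases hi : i = 1 <;> by_cases hj : j = 1 <;> simp [hi, hj]
  rw [h1, h2] at hJ
  simp only [ssign, zero_ne_one, and_false, false_and, if_false, one_smul, map_neg] at hJ hs
  rw [smul_neg, smul_smul, hs, one_smul] at hJ
  rw [← sub_eq_zero, ← hJ]
  abel

lemma bk_self {x : V} (hx : x ∈ A.g 0) : A.bk x x = 0 := by
  have h : A.bk x x = -A.bk x x := by simpa [ssign] using A.skew 0 0 x hx x hx
  have h2 : (2 : ℂ) • A.bk x x = 0 := by rw [two_smul, ← eq_neg_iff_add_eq_zero, ← h]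
  exact (smul_eq_zero.1 h2).resolve_left two_ne_zero

lemma bk_even_swap {a : ZMod 2} {x y : V} (hx : x ∈ A.g a) (hy : y ∈ A.g 0) :
    A.bk x y = -A.bk y x := by
  simpa [ssign] using A.skew a 0 x hx y hy

lemma bk_odd_swap {x y : V} (hx : x ∈ A.g 1) (hy : y ∈ A.g 1) : A.bk x y = A.bk y x := by
  simpa [ssign] using A.skew 1 1 x hx y hy

lemma bk_C_one_mem {a : ZMod 2} {k : ℕ} {c y : V} (hc : c ∈ A.C 0 1) (hy : y ∈ A.C a k) :
    A.bk c y ∈ A.C a (k + 2) := by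
  suffices h : A.C 0 1 ≤ (A.C a (k + 2)).comap (A.bk.flip y) from h hc
  refine Submodule.span_le.2 ?_
  rintro _ ⟨u, hu, v, hv, rfl⟩
  have hv : v ∈ A.g 0 := hv
  have h := leibniz hu hv (A.C_le_g a k hy)
  change A.bk (A.bk u v) y ∈ A.C a (k + 2)
  rw [← sub_eq_of_eq_add h]
  exact sub_mem (bk_mem_C hu (bk_mem_C hv hy)) (bk_mem_C hv (bk_mem_C hu hy))

end DescendingSequences

/-- The subspaces `W a i` witness that `A` is naturally graded. -/
structure IsNaturalGrading (A : LieSuperAlg V) (W : ZMod 2 → ℕ → Submodule ℂ V) : Prop where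
  sup_eq : ∀ a k, A.C a k = W a (k + 1) ⊔ A.C a (k + 1)
  inf_eq : ∀ a k, W a (k + 1) ⊓ A.C a (k + 1) = ⊥
  bk_mem : ∀ a b : ZMod 2, ∀ i j : ℕ, ∀ x ∈ W a i, ∀ y ∈ W b j, A.bk x y ∈ W (a + b) (i + j)

namespace IsNaturalGrading

variable {W : ZMod 2 → ℕ → Submodule ℂ V}

lemma le_C (hW : A.IsNaturalGrading W) (a : ZMod 2) (k : ℕ) : W a (k + 1) ≤ A.C a k := by
  rw [hW.sup_eq a k]
  exact le_sup_left

lemma le_g (hW : A.IsNaturalGrading W) (a : ZMod 2) (k : ℕ) : W a (k + 1) ≤ A.g a :=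
  (hW.le_C a k).trans (A.C_le_g a k)

lemma eq_bot_of_C_eq_bot (hW : A.IsNaturalGrading W) {a : ZMod 2} {n k : ℕ}
    (hn : A.C a n = ⊥) (hk : n ≤ k) : W a (k + 1) = ⊥ :=
  le_bot_iff.1 (((hW.le_C a k).trans (A.C_antitone a hk)).trans hn.le)

lemma ne_bot_of_C_ne_bot (hW : A.IsNaturalGrading W) {a : ZMod 2} {n k : ℕ}
    (hn : A.C a n = ⊥) (hk : A.C a k ≠ ⊥) : W a (k + 1) ≠ ⊥ := by
  intro h
  refine hk (C_eq_bot_of_le_succ ?_ hn)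
  conv_lhs => rw [hW.sup_eq a k, h, bot_sup_eq]

lemma finrank_add [FiniteDimensional ℂ V] (hW : A.IsNaturalGrading W) (a : ZMod 2) (k : ℕ) :
    Module.finrank ℂ (W a (k + 1)) + Module.finrank ℂ (A.C a (k + 1)) =
      Module.finrank ℂ (A.C a k) := by
  have h := Submodule.finrank_sup_add_finrank_inf_eq (W a (k + 1)) (A.C a (k + 1))
  rw [← hW.sup_eq, hW.inf_eq, finrank_bot, add_zero] at h
  exact h.symm

/-- The even part of degree one acts nontrivially on `W a (k + 1)` unless `C a (k + 1)` vanishes. -/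
lemma exists_bk_ne_zero (hW : A.IsNaturalGrading W) {a : ZMod 2} {n k : ℕ}
    (hn : A.C a n = ⊥) (hk : A.C a (k + 1) ≠ ⊥) :
    ∃ w ∈ W 0 1, ∃ y ∈ W a (k + 1), A.bk w y ≠ 0 := by
  by_contra! H
  refine hk (C_eq_bot_of_le_succ (Submodule.span_le.2 ?_) hn)
  rintro _ ⟨x, hx, y, hy, rfl⟩
  have hx' : x ∈ A.C 0 0 := hx
  have hy' := hy
  rw [hW.sup_eq] at hx' hy'
  obtain ⟨w, hw, c, hc, rfl⟩ := Submodule.mem_sup.1 hx'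
  obtain ⟨u, hu, d, hd, rfl⟩ := Submodule.mem_sup.1 hy'
  have h : A.bk (w + c) (u + d) = A.bk w d + A.bk c (u + d) := by
    simp only [map_add, LinearMap.add_apply, H w hw u hu]
    abel
  rw [h]
  exact add_mem (bk_mem_C (hW.le_g 0 0 hw) hd) (bk_C_one_mem hc hy)

lemma exists_generic (hW : A.IsNaturalGrading W) {S : Finset (ZMod 2 × ℕ)} {n : ℕ}
    (hS : ∀ s ∈ S, A.C s.1 n = ⊥ ∧ A.C s.1 (s.2 + 1) ≠ ⊥) :
    ∃ q ∈ W 0 1, ∀ s ∈ S, ∃ y ∈ W s.1 (s.2 + 1), A.bk q y ≠ 0 := by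
  by_contra! H
  obtain ⟨⟨s, hs⟩, h⟩ := Subspace.exists_eq_top_of_iUnion_eq_univ
    (p := fun s : S => LinearMap.ker (A.bk.domRestrict₁₂ (W 0 1) (W s.1.1 (s.1.2 + 1)))) (by
      refine Set.eq_univ_of_forall fun q => ?_
      obtain ⟨s, hs, hq⟩ := H q q.2
      refine Set.mem_iUnion.2 ⟨⟨s, hs⟩, ?_⟩
      ext y
      exact hq y y.2)
  obtain ⟨w, hw, y, hy, hne⟩ := hW.exists_bk_ne_zero (hS s hs).1 (hS s hs).2
  have hmem : (⟨w, hw⟩ : W 0 1) ∈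
      LinearMap.ker (A.bk.domRestrict₁₂ (W 0 1) (W s.1 (s.2 + 1))) := by
    rw [h]
    trivial
  exact hne (LinearMap.congr_fun hmem ⟨y, hy⟩)

/-- A vector spanning a component is sent by `ad q` to a vector spanning the next one, provided
that component is a line and `ad q` does not vanish on the first component. -/
lemma eq_span_bk [FiniteDimensional ℂ V] (hW : A.IsNaturalGrading W) {a : ZMod 2} {k : ℕ} {q x : V}
    (hq : q ∈ W 0 1) (hx : W a (k + 1) = Submodule.span ℂ {x})
    (hy : ∃ y ∈ W a (k + 1), A.bk q y ≠ 0) (h1 : Module.finrank ℂ (W a (k + 2)) = 1) :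
    W a (k + 2) = Submodule.span ℂ {A.bk q x} := by
  obtain ⟨y, hy, hne⟩ := hy
  have hx' : x ∈ W a (k + 1) := hx ▸ Submodule.mem_span_singleton_self x
  rw [hx] at hy
  obtain ⟨c, rfl⟩ := Submodule.mem_span_singleton.1 hy
  have hqx : A.bk q x ≠ 0 := fun h => hne (by rw [map_smul, h, smul_zero])
  have hmem : A.bk q x ∈ W a (k + 2) := by
    have h := hW.bk_mem 0 a 1 (k + 1) q hq x hx'
    rwa [zero_add, show 1 + (k + 1) = k + 2 by omega] at h
  refine (Submodule.eq_of_le_of_finrank_le ?_ ?_).symm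
  · simpa using hmem
  · rw [h1, finrank_span_singleton hqx]

end IsNaturalGrading

/-- `q`, `p` span the even part of degree one, `r` the odd part of degree one, and `ad q` generates
the remaining homogeneous components out of `p` and `r`. -/
structure IsFrame (A : LieSuperAlg V) (W : ZMod 2 → ℕ → Submodule ℂ V) (q p r : V) : Prop where
  deg_one : W 0 1 = Submodule.span ℂ {q, p}
  even : ∀ k, W 0 (k + 2) = Submodule.span ℂ {(A.bk q)^[k + 1] p}
  odd : ∀ k, W 1 (k + 1) = Submodule.span ℂ {(A.bk q)^[k] r}

lemma IsNaturalGrading.exists_frame [FiniteDimensional ℂ V] {W : ZMod 2 → ℕ → Submodule ℂ V}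
    (hW : A.IsNaturalGrading W) (hfil : A.IsFiliform 5 3) :
    ∃ q p r, A.bk q p ≠ 0 ∧ A.IsFrame W q p r ∧
      ∀ p' ∈ W 0 1, A.bk q p' ≠ 0 → A.IsFrame W q p' r := by
  obtain ⟨-, hd0, hd1, h04, h12, h05, h13⟩ := hfil
  simp only [Nat.add_one_sub_one, Nat.reduceAdd] at h04 h12 hd0
  have h05' : A.C 0 5 = ⊥ := h05
  have h15 : A.C 1 5 = ⊥ := le_bot_iff.1 ((A.C_antitone 1 (by norm_num)).trans h13.le)
  have ne0 : ∀ k ≤ 4, A.C 0 k ≠ ⊥ := fun k hk h =>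
    h04 (le_bot_iff.1 ((A.C_antitone 0 hk).trans h.le))
  have ne1 : ∀ k ≤ 2, A.C 1 k ≠ ⊥ := fun k hk h =>
    h12 (le_bot_iff.1 ((A.C_antitone 1 hk).trans h.le))
  have pos0 : ∀ k ≤ 4, 1 ≤ Module.finrank ℂ (W 0 (k + 1)) := fun k hk =>
    Submodule.one_le_finrank_iff.2 (hW.ne_bot_of_C_ne_bot h05 (ne0 k hk))
  have pos1 : ∀ k ≤ 2, 1 ≤ Module.finrank ℂ (W 1 (k + 1)) := fun k hk =>
    Submodule.one_le_finrank_iff.2 (hW.ne_bot_of_C_ne_bot h13 (ne1 k hk))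
  obtain ⟨q, hq, hgen⟩ := hW.exists_generic (n := 5)
    (S := {(0, 0), (0, 1), (0, 2), (0, 3), (1, 0), (1, 1)}) (by
      simp [h05', h15, ne0, ne1])
  simp only [Finset.mem_insert, Finset.mem_singleton, forall_eq_or_imp, forall_eq] at hgen
  obtain ⟨g00, g01, g02, g03, g10, g11⟩ := hgen
  have indep : ∀ p, A.bk q p ≠ 0 → LinearIndependent ℂ ![q, p] := by
    intro p hqp
    refine LinearIndependent.pair_iff.2 fun s t hst => ?_
    have h := congrArg (A.bk q) hst
    rw [map_add, map_smul, map_smul, bk_self (hW.le_g 0 0 hq), smul_zero, zero_add, map_zero,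
      smul_eq_zero] at h
    have ht : t = 0 := h.resolve_right hqp
    have hq0 : q ≠ 0 := by
      rintro rfl
      simp at hqp
    rw [ht, zero_smul, add_zero, smul_eq_zero] at hst
    exact ⟨hst.resolve_right hq0, ht⟩
  have rank2 : ∀ p, A.bk q p ≠ 0 → Module.finrank ℂ (Submodule.span ℂ {q, p}) = 2 := by
    intro p hqp
    have h := finrank_span_eq_card (indep p hqp)
    rwa [show Set.range ![q, p] = {q, p} by
      simp [Matrix.range_cons, Matrix.range_empty, Set.pair_comm],
      Fintype.card_fin] at h
  have le01 : ∀ p ∈ W 0 1, Submodule.span ℂ {q, p} ≤ W 0 1 := by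
    intro p hp
    refine Submodule.span_le.2 ?_
    rintro _ (rfl | rfl)
    exacts [hq, hp]
  obtain ⟨p, hp, hqp⟩ := g00
  have two_le : 2 ≤ Module.finrank ℂ (W 0 1) := by
    have h := Submodule.finrank_mono (le01 p hp)
    rwa [rank2 p hqp] at h
  have e0 := hW.finrank_add 0 0
  have e1 := hW.finrank_add 0 1
  have e2 := hW.finrank_add 0 2
  have e3 := hW.finrank_add 0 3
  have e4 := hW.finrank_add 0 4
  have o0 := hW.finrank_add 1 0
  have o1 := hW.finrank_add 1 1
  have o2 := hW.finrank_add 1 2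
  rw [show A.C 0 0 = A.g 0 from rfl] at e0
  rw [show A.C 1 0 = A.g 1 from rfl] at o0
  rw [show A.C 0 (4 + 1) = ⊥ from h05, finrank_bot] at e4
  rw [show A.C 1 (2 + 1) = ⊥ from h13, finrank_bot] at o2
  have p1 := pos0 1 (by norm_num)
  have p2 := pos0 2 (by norm_num)
  have p3 := pos0 3 (by norm_num)
  have p4 := pos0 4 (by norm_num)
  have q0 := pos1 0 (by norm_num)
  have q1 := pos1 1 (by norm_num)
  have q2 := pos1 2 (by norm_num)
  simp only [zero_add, Nat.reduceAdd] at *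
  obtain ⟨r, hr, hqr⟩ := g10
  have hr0 : r ≠ 0 := by
    rintro rfl
    simp at hqr
  have s1 : W 1 1 = Submodule.span ℂ {r} := by
    refine (Submodule.eq_of_le_of_finrank_le ?_ ?_).symm
    · simpa using hr
    · rw [finrank_span_singleton hr0]
      omega
  have s2 := hW.eq_span_bk (k := 0) hq s1 ⟨r, hr, hqr⟩ (by simp only [Nat.reduceAdd]; omega)
  have s3 := hW.eq_span_bk (k := 1) hq s2 g11 (by simp only [Nat.reduceAdd]; omega)
  have odd : ∀ k, W 1 (k + 1) = Submodule.span ℂ {(A.bk q)^[k] r} := by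
    intro k
    obtain hk | hk := lt_or_ge k 3
    · interval_cases k
      exacts [s1, s2, s3]
    · have hb : ∀ j, W 1 (j + 3 + 1) = ⊥ := fun j =>
        hW.eq_bot_of_C_eq_bot h13 (by omega)
      have hz : (A.bk q)^[3] r = 0 := by
        have hm : (A.bk q)^[2] r ∈ W 1 3 := by
          rw [s3]; exact Submodule.mem_span_singleton_self _
        have := hW.bk_mem 0 1 1 3 q hq _ hm
        simpa [hb 0, Function.iterate_succ_apply'] using this
      obtain ⟨j, rfl⟩ := Nat.exists_eq_add_of_le' hk
      rw [hb j, Function.iterate_add_apply, hz, Function.iterate_fixed (map_zero _)]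
      simp
  have frame : ∀ p' ∈ W 0 1, A.bk q p' ≠ 0 → A.IsFrame W q p' r := by
    intro p' hp' hqp'
    have t1 : W 0 1 = Submodule.span ℂ {q, p'} := by
      refine (Submodule.eq_of_le_of_finrank_le (le01 p' hp') ?_).symm
      rw [rank2 p' hqp']
      omega
    have t2 : W 0 2 = Submodule.span ℂ {A.bk q p'} := by
      refine (Submodule.eq_of_le_of_finrank_le ?_ ?_).symm
      · simpa using hW.bk_mem 0 0 1 1 q hq p' hp'
      · rw [finrank_span_singleton hqp']
        omega
    have t3 := hW.eq_span_bk (k := 1) hq t2 g01 (by simp only [Nat.reduceAdd]; omega)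
    have t4 := hW.eq_span_bk (k := 2) hq t3 g02 (by simp only [Nat.reduceAdd]; omega)
    have t5 := hW.eq_span_bk (k := 3) hq t4 g03 (by simp only [Nat.reduceAdd]; omega)
    refine ⟨t1, fun k => ?_, odd⟩
    obtain hk | hk := lt_or_ge k 4
    · interval_cases k
      exacts [t2, t3, t4, t5]
    · have hb : ∀ j, W 0 (j + 5 + 1) = ⊥ := fun j =>
        hW.eq_bot_of_C_eq_bot h05 (by omega)
      have hz : (A.bk q)^[5] p' = 0 := by
        have hm : (A.bk q)^[4] p' ∈ W 0 5 := by
          rw [t5]; exact Submodule.mem_span_singleton_self _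
        have := hW.bk_mem 0 0 1 5 q hq _ hm
        simpa [hb 0, Function.iterate_succ_apply'] using this
      obtain ⟨j, rfl⟩ := Nat.exists_eq_add_of_le' hk
      rw [show j + 4 + 2 = j + 5 + 1 by omega, hb j, show j + 4 + 1 = j + 5 by omega,
        Function.iterate_add_apply, hz, Function.iterate_fixed (map_zero _)]
      simp
  exact ⟨q, p, r, hqp, frame p hp hqp, frame⟩

/-- `x` and `y` are sequences of even, resp. odd, homogeneous vectors which are adapted to `ad (x 0)`
and span the superalgebra; the index is the degree, except that `x 0` has degree one. -/
structure IsGradedBasis (A : LieSuperAlg V) (x y : ℕ → V) : Prop where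
  x_mem : ∀ i, x i ∈ A.g 0
  y_mem : ∀ j, 1 ≤ j → y j ∈ A.g 1
  ad_x : ∀ i, 1 ≤ i → A.bk (x 0) (x i) = x (i + 1)
  ad_y : ∀ j, 1 ≤ j → A.bk (x 0) (y j) = y (j + 1)
  x_eq_zero : ∀ i, 6 ≤ i → x i = 0
  y_eq_zero : ∀ j, 4 ≤ j → y j = 0
  x_ne_zero : ∀ i, 2 ≤ i → i ≤ 5 → x i ≠ 0
  bk_xx : ∀ i j, 1 ≤ i → 1 ≤ j → ∃ c : ℂ, A.bk (x i) (x j) = c • x (i + j)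
  bk_xy : ∀ i j, 1 ≤ i → 1 ≤ j → ∃ c : ℂ, A.bk (x i) (y j) = c • y (i + j)
  bk_yy : ∀ i j, 1 ≤ i → 1 ≤ j → ∃ c : ℂ, A.bk (y i) (y j) = c • x (i + j)
  C_one_le : A.C 0 1 ≤ Submodule.span ℂ (x '' Set.Icc 2 5)
  even_le : A.g 0 ≤ Submodule.span ℂ (x '' Set.Icc 0 5)
  odd_le : A.g 1 ≤ Submodule.span ℂ (y '' Set.Icc 1 3)

lemma IsNaturalGrading.C_le_span {W : ZMod 2 → ℕ → Submodule ℂ V}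
    (hW : A.IsNaturalGrading W) {a : ZMod 2} {n k : ℕ} {z : ℕ → V}
    (hn : A.C a n = ⊥) (hz : ∀ i, k + 1 ≤ i → W a i ≤ Submodule.span ℂ {z i}) :
    A.C a k ≤ Submodule.span ℂ (z '' Set.Icc (k + 1) n) := by
  obtain hk | hk := le_total n k
  · rw [le_bot_iff.1 ((A.C_antitone a hk).trans hn.le)]
    exact bot_le
  · induction hm : n - k generalizing k with
    | zero =>
      obtain rfl : k = n := by omega
      simp [hn]
    | succ m ih =>
      rw [hW.sup_eq]
      refine sup_le ((hz (k + 1) le_rfl).trans (Submodule.span_mono ?_))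
        ((ih (k := k + 1) (fun i hi => hz i (by omega)) (by omega) (by omega)).trans
          (Submodule.span_mono (Set.image_mono ?_)))
      · rw [Set.singleton_subset_iff]
        exact ⟨k + 1, ⟨le_rfl, by omega⟩, rfl⟩
      · exact Set.Icc_subset_Icc_left (by omega)

lemma IsFrame.isGradedBasis {W : ZMod 2 → ℕ → Submodule ℂ V} {q p r : V}
    (hF : A.IsFrame W q p r) (hW : A.IsNaturalGrading W) (hfil : A.IsFiliform 5 3) :
    A.IsGradedBasis (fun i => Nat.casesOn i q fun k => (A.bk q)^[k] p)
      (fun j => (A.bk q)^[j - 1] r) := by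
  obtain ⟨-, -, -, h04, -, h05, h13⟩ := hfil
  have h05 : A.C 0 5 = ⊥ := h05
  set x : ℕ → V := fun i => Nat.casesOn i q fun k => (A.bk q)^[k] p
  set y : ℕ → V := fun j => (A.bk q)^[j - 1] r
  have even : ∀ k, W 0 (k + 2) = Submodule.span ℂ {x (k + 2)} := hF.even
  have odd : ∀ k, W 1 (k + 1) = Submodule.span ℂ {y (k + 1)} := hF.odd
  have q_mem : q ∈ W 0 1 := hF.deg_one ▸ Submodule.subset_span (by simp)
  have p_mem : p ∈ W 0 1 := hF.deg_one ▸ Submodule.subset_span (by simp)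
  have x_memW : ∀ k, x (k + 1) ∈ W 0 (k + 1) := by
    rintro (_ | k)
    · exact p_mem
    · exact even k ▸ Submodule.mem_span_singleton_self _
  have y_memW : ∀ k, y (k + 1) ∈ W 1 (k + 1) := fun k =>
    odd k ▸ Submodule.mem_span_singleton_self _
  refine
    { x_mem := ?_, y_mem := ?_, ad_x := ?_, ad_y := ?_, x_eq_zero := ?_, y_eq_zero := ?_,
      x_ne_zero := ?_, bk_xx := ?_, bk_xy := ?_, bk_yy := ?_, C_one_le := ?_,
      even_le := ?_, odd_le := ?_ }
  · rintro (_ | k)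
    · exact hW.le_g 0 0 q_mem
    · exact hW.le_g 0 k (x_memW k)
  · intro j hj
    obtain ⟨k, rfl⟩ := Nat.exists_eq_add_of_le' hj
    exact hW.le_g 1 k (y_memW k)
  · intro i hi
    obtain ⟨k, rfl⟩ := Nat.exists_eq_add_of_le' hi
    exact (Function.iterate_succ_apply' _ _ _).symm
  · intro j hj
    obtain ⟨k, rfl⟩ := Nat.exists_eq_add_of_le' hj
    exact (Function.iterate_succ_apply' _ _ _).symm
  · intro i hi
    obtain ⟨k, rfl⟩ := Nat.exists_eq_add_of_le' hi
    have h := x_memW (k + 5)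
    rwa [hW.eq_bot_of_C_eq_bot h05 (by omega), Submodule.mem_bot] at h
  · intro j hj
    obtain ⟨k, rfl⟩ := Nat.exists_eq_add_of_le' hj
    have h := y_memW (k + 3)
    rwa [hW.eq_bot_of_C_eq_bot h13 (by omega), Submodule.mem_bot] at h
  · intro i hi hi5 h0
    obtain ⟨k, rfl⟩ := Nat.exists_eq_add_of_le' hi
    refine hW.ne_bot_of_C_ne_bot (k := k + 1) h05 (fun h => h04 ?_) ?_
    · exact le_bot_iff.1 ((A.C_antitone 0 (by omega)).trans h.le)
    · rw [even k, h0]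
      simp
  · intro i j hi hj
    obtain ⟨k, rfl⟩ := Nat.exists_eq_add_of_le' hi
    obtain ⟨l, rfl⟩ := Nat.exists_eq_add_of_le' hj
    have h := hW.bk_mem 0 0 _ _ _ (x_memW k) _ (x_memW l)
    rw [show k + 1 + (l + 1) = k + l + 2 by omega] at h ⊢
    rw [add_zero, even] at h
    obtain ⟨c, hc⟩ := Submodule.mem_span_singleton.1 h
    exact ⟨c, hc.symm⟩
  · intro i j hi hj
    obtain ⟨k, rfl⟩ := Nat.exists_eq_add_of_le' hi
    obtain ⟨l, rfl⟩ := Nat.exists_eq_add_of_le' hj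
    have h := hW.bk_mem 0 1 _ _ _ (x_memW k) _ (y_memW l)
    rw [show k + 1 + (l + 1) = k + l + 1 + 1 by omega] at h ⊢
    rw [zero_add, odd] at h
    obtain ⟨c, hc⟩ := Submodule.mem_span_singleton.1 h
    exact ⟨c, hc.symm⟩
  · intro i j hi hj
    obtain ⟨k, rfl⟩ := Nat.exists_eq_add_of_le' hi
    obtain ⟨l, rfl⟩ := Nat.exists_eq_add_of_le' hj
    have h := hW.bk_mem 1 1 _ _ _ (y_memW k) _ (y_memW l)
    rw [show k + 1 + (l + 1) = k + l + 2 by omega] at h ⊢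
    rw [show (1 + 1 : ZMod 2) = 0 from rfl, even] at h
    obtain ⟨c, hc⟩ := Submodule.mem_span_singleton.1 h
    exact ⟨c, hc.symm⟩
  · refine hW.C_le_span (k := 1) h05 fun i hi => ?_
    obtain ⟨k, rfl⟩ := Nat.exists_eq_add_of_le' hi
    exact (even k).le
  · change A.C 0 0 ≤ _
    rw [hW.sup_eq, zero_add, hF.deg_one]
    refine sup_le (Submodule.span_le.2 ?_)
      ((hW.C_le_span (k := 1) (z := x) h05 fun i hi => ?_).trans
        (Submodule.span_mono (Set.image_mono ?_)))
    · rintro _ (rfl | rfl)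
      · exact Submodule.subset_span ⟨0, by simp, rfl⟩
      · exact Submodule.subset_span ⟨1, by simp, rfl⟩
    · obtain ⟨k, rfl⟩ := Nat.exists_eq_add_of_le' hi
      exact (even k).le
    · exact Set.Icc_subset_Icc_left (by omega)
  · refine hW.C_le_span (k := 0) h13 fun i hi => ?_
    obtain ⟨k, rfl⟩ := Nat.exists_eq_add_of_le' hi
    exact (odd k).le

lemma bk_eq_zero_of_mem_span {S T : Set V} (h : ∀ s ∈ S, ∀ t ∈ T, A.bk s t = 0) {u v : V}
    (hu : u ∈ Submodule.span ℂ S) (hv : v ∈ Submodule.span ℂ T) : A.bk u v = 0 := by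
  have hv' : ∀ s ∈ S, A.bk s v = 0 := fun s hs =>
    (Submodule.span_le (p := LinearMap.ker (A.bk s))).2 (h s hs) hv
  exact (Submodule.span_le (p := LinearMap.ker (A.bk.flip v))).2 hv' hu

lemma eq_of_smul_eq_smul {a b : ℂ} {v : V} (hv : v ≠ 0) (h : a • v = b • v) : a = b :=
  smul_left_injective ℂ hv h

namespace IsGradedBasis

variable {x y : ℕ → V}

lemma bk_xx_eq_zero (hB : A.IsGradedBasis x y) {i j : ℕ} (hi : 1 ≤ i) (hj : 1 ≤ j)
    (hij : 6 ≤ i + j) : A.bk (x i) (x j) = 0 := by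
  obtain ⟨c, hc⟩ := hB.bk_xx i j hi hj
  rw [hc, hB.x_eq_zero _ hij, smul_zero]

lemma bk_xy_eq_zero (hB : A.IsGradedBasis x y) {i j : ℕ} (hi : 1 ≤ i) (hj : 1 ≤ j)
    (hij : 4 ≤ i + j) : A.bk (x i) (y j) = 0 := by
  obtain ⟨c, hc⟩ := hB.bk_xy i j hi hj
  rw [hc, hB.y_eq_zero _ hij, smul_zero]

/-- Invariance of the odd products under `ad (x 0)` determines them up to a common factor. -/
lemma exists_odd_products (hB : A.IsGradedBasis x y) :
    ∃ γ : ℂ, A.bk (y 1) (y 1) = (6 * γ) • x 2 ∧ A.bk (y 1) (y 2) = (3 * γ) • x 3 ∧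
      A.bk (y 1) (y 3) = γ • x 4 ∧ A.bk (y 2) (y 2) = (2 * γ) • x 4 ∧
      A.bk (y 2) (y 3) = γ • x 5 ∧ A.bk (y 3) (y 3) = 0 := by
  obtain ⟨α, hα⟩ := hB.bk_yy 1 1 le_rfl le_rfl
  obtain ⟨β, hβ⟩ := hB.bk_yy 1 2 le_rfl (by omega)
  obtain ⟨γ, hγ⟩ := hB.bk_yy 1 3 le_rfl (by omega)
  obtain ⟨δ, hδ⟩ := hB.bk_yy 2 2 (by omega) (by omega)
  obtain ⟨ε, hε⟩ := hB.bk_yy 2 3 (by omega) (by omega)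
  obtain ⟨ζ, hζ⟩ := hB.bk_yy 3 3 (by omega) (by omega)
  rw [hB.x_eq_zero (3 + 3) (by omega), smul_zero] at hζ
  simp only [Nat.reduceAdd] at hα hβ hγ hδ hε
  have y1 := hB.y_mem 1 (by omega)
  have y2 := hB.y_mem 2 (by omega)
  have y3 := hB.y_mem 3 (by omega)
  have hβ' := (bk_odd_swap y2 y1).trans hβ
  have a2 := hB.ad_x 2 (by omega)
  have a3 := hB.ad_x 3 (by omega)
  have a4 := hB.ad_x 4 (by omega)
  have b1 := hB.ad_y 1 (by omega)
  have b2 := hB.ad_y 2 (by omega)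
  have b3 := (hB.ad_y 3 (by omega)).trans (hB.y_eq_zero 4 le_rfl)
  have L1 := leibniz (hB.x_mem 0) y1 y1
  have L2 := leibniz (hB.x_mem 0) y1 y2
  have L3 := leibniz (hB.x_mem 0) y1 y3
  have L4 := leibniz (hB.x_mem 0) y2 y2
  have hε' := (bk_odd_swap y3 y2).trans hε
  simp only [Nat.reduceAdd] at a2 a3 a4 b1 b2
  rw [hα, b1, hβ, hβ', map_smul, a2, ← add_smul] at L1
  rw [hβ, b1, b2, hδ, hγ, map_smul, a3, ← add_smul] at L2
  rw [hγ, b1, b3, hε, map_zero, map_smul, a4, add_zero] at L3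
  rw [hδ, b2, hε, hε', map_smul, a4, ← add_smul] at L4
  have E1 := eq_of_smul_eq_smul (hB.x_ne_zero 3 (by omega) (by omega)) L1
  have E2 := eq_of_smul_eq_smul (hB.x_ne_zero 4 (by omega) (by omega)) L2
  have E3 := eq_of_smul_eq_smul (hB.x_ne_zero 5 (by omega) (by omega)) L3
  have E4 := eq_of_smul_eq_smul (hB.x_ne_zero 5 (by omega) (by omega)) L4
  subst E3
  have hδ2 : δ = 2 * γ := by rw [E4]; ring
  have hβ2 : β = 3 * γ := by rw [E2, hδ2]; ring
  have hα2 : α = 6 * γ := by rw [E1, hβ2]; ring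
  exact ⟨γ, hα2 ▸ hα, hβ2 ▸ hβ, hγ, hδ2 ▸ hδ, hε, hζ⟩

/-- Once `[x 1, x 2] = 0`, non-degeneracy forces all brackets of `x i`, `i ≥ 1`, with `x j`, `j ≥ 1`,
and with `y j` to vanish. -/
lemma exists_products (hB : A.IsGradedBasis x y) (h12 : A.bk (x 1) (x 2) = 0)
    (hnd : A.NonDegenerate) :
    ∃ γ : ℂ, γ ≠ 0 ∧ A.bk (y 1) (y 1) = (6 * γ) • x 2 ∧ A.bk (y 1) (y 2) = (3 * γ) • x 3 ∧
      A.bk (y 1) (y 3) = γ • x 4 ∧ A.bk (y 2) (y 2) = (2 * γ) • x 4 ∧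
      A.bk (y 2) (y 3) = γ • x 5 ∧ A.bk (y 3) (y 3) = 0 ∧
      (∀ i j, 1 ≤ i → 1 ≤ j → A.bk (x i) (x j) = 0) ∧
      (∀ i j, 1 ≤ i → 1 ≤ j → A.bk (x i) (y j) = 0) := by
  obtain ⟨γ, hα, hβ, hγ, hδ, hε, hζ⟩ := hB.exists_odd_products
  have y1 := hB.y_mem 1 (by omega)
  have y2 := hB.y_mem 2 (by omega)
  have y3 := hB.y_mem 3 (by omega)
  have x0 := hB.x_mem 0
  have x1 := hB.x_mem 1
  have x2 := hB.x_mem 2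
  have x3 := hB.x_mem 3
  have hβ' := (bk_odd_swap y2 y1).trans hβ
  have hγ' := (bk_odd_swap y3 y1).trans hγ
  have hε' := (bk_odd_swap y3 y2).trans hε
  have hγ0 : γ ≠ 0 := by
    rintro rfl
    simp only [mul_zero, zero_smul] at *
    obtain ⟨u, hu, v, hv, hne⟩ := hnd
    refine hne (bk_eq_zero_of_mem_span ?_ (hB.odd_le hu) (hB.odd_le hv))
    rintro _ ⟨i, ⟨hi1, hi3⟩, rfl⟩ _ ⟨j, ⟨hj1, hj3⟩, rfl⟩
    interval_cases i <;> interval_cases j <;> assumption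
  have ne := hB.x_ne_zero
  have a1 : A.bk (x 0) (x 1) = x 2 := hB.ad_x 1 le_rfl
  have a2 : A.bk (x 0) (x 2) = x 3 := hB.ad_x 2 (by omega)
  have a3 : A.bk (x 0) (x 3) = x 4 := hB.ad_x 3 (by omega)
  have b1 : A.bk (x 0) (y 1) = y 2 := hB.ad_y 1 le_rfl
  have h13 : A.bk (x 1) (x 3) = 0 := by
    have L := leibniz x0 x1 x2
    rwa [h12, a1, a2, bk_self x2, map_zero, zero_add, eq_comm] at L
  obtain ⟨c, hc⟩ := hB.bk_xx 1 4 le_rfl (by omega)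
  obtain ⟨e, he⟩ := hB.bk_xy 1 1 le_rfl le_rfl
  obtain ⟨f, hf⟩ := hB.bk_xy 1 2 le_rfl (by omega)
  simp only [Nat.reduceAdd] at hc he hf
  have he0 : e = 0 := by
    have L := leibniz x1 y1 y1
    rw [hα, he, map_smul, h12, map_smul, map_smul, LinearMap.smul_apply, hβ, hβ', smul_zero,
      ← add_smul, smul_smul, eq_comm, smul_eq_zero] at L
    have L' := L.resolve_right (ne 3 (by omega) (by omega))
    have : e * γ = 0 := by linear_combination (1 / 6) * L'
    exact (mul_eq_zero.1 this).resolve_right hγ0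
  rw [he0, zero_smul] at he
  have hf0 : f = 0 := by
    have L := leibniz x1 y1 y2
    rw [hβ, he, hf, map_smul, h13, map_smul, map_zero, LinearMap.zero_apply, hγ, smul_zero,
      zero_add, smul_smul, eq_comm, smul_eq_zero] at L
    exact (mul_eq_zero.1 (L.resolve_right (ne 4 (by omega) (by omega)))).resolve_right hγ0
  rw [hf0, zero_smul] at hf
  have h1y3 : A.bk (x 1) (y 3) = 0 := hB.bk_xy_eq_zero le_rfl (by omega) (by omega)
  have h14 : A.bk (x 1) (x 4) = 0 := by
    have L := leibniz x1 y1 y3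
    rw [hγ, he, h1y3, map_smul, map_zero, map_zero, LinearMap.zero_apply, add_zero,
      smul_eq_zero] at L
    exact L.resolve_left hγ0
  have h23 : A.bk (x 2) (x 3) = 0 := by
    have L := leibniz x0 x1 x3
    rwa [h13, a1, a3, h14, map_zero, add_zero, eq_comm] at L
  have h2y1 : A.bk (x 2) (y 1) = 0 := by
    have L := leibniz x0 x1 y1
    rwa [he, a1, b1, hf, map_zero, add_zero, eq_comm] at L
  have h11 := bk_self x1
  have h22 := bk_self x2
  have swap : ∀ i j, A.bk (x i) (x j) = 0 → A.bk (x j) (x i) = 0 := fun i j h => by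
    rw [bk_even_swap (hB.x_mem j) (hB.x_mem i), h, neg_zero]
  have h21 := swap 1 2 h12
  have h31 := swap 1 3 h13
  have h41 := swap 1 4 h14
  have h32 := swap 2 3 h23
  refine ⟨γ, hγ0, hα, hβ, hγ, hδ, hε, hζ, fun i j hi hj => ?_, fun i j hi hj => ?_⟩
  · obtain hij | hij := le_or_gt 6 (i + j)
    · exact hB.bk_xx_eq_zero hi hj hij
    · have : i ≤ 4 := by omega
      have : j ≤ 4 := by omega
      interval_cases i <;> interval_cases j <;> first | assumption | omega
  · obtain hij | hij := le_or_gt 4 (i + j)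
    · exact hB.bk_xy_eq_zero hi hj hij
    · have : i ≤ 2 := by omega
      have : j ≤ 2 := by omega
      interval_cases i <;> interval_cases j <;> first | assumption | omega

lemma isAdaptedBasis [FiniteDimensional ℂ V] (hB : A.IsGradedBasis x y) (hfil : A.IsFiliform 5 3)
    {s : ℂ} (hs : s ≠ 0) :
    A.IsAdaptedBasis 5 3 (fun i => if i = 0 then x 0 else s • x i) y := by
  set X : ℕ → V := fun i => if i = 0 then x 0 else s • x i with hX
  have hspan : Submodule.span ℂ (Set.range
      (Sum.elim (fun i : Fin (5 + 1) => X i.val) (fun j : Fin 3 => y (j.val + 1)))) = ⊤ := by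
    rw [eq_top_iff, ← A.compl.sup_eq_top]
    refine sup_le (hB.even_le.trans (Submodule.span_le.2 ?_))
      (hB.odd_le.trans (Submodule.span_le.2 ?_))
    · rintro _ ⟨i, ⟨-, hi⟩, rfl⟩
      have hXi : X i ∈ Submodule.span ℂ (Set.range
          (Sum.elim (fun i : Fin (5 + 1) => X i.val) (fun j : Fin 3 => y (j.val + 1)))) :=
        Submodule.subset_span ⟨Sum.inl ⟨i, by omega⟩, rfl⟩
      by_cases h0 : i = 0
      · simpa [hX, h0] using hXi
      · have h := Submodule.smul_mem _ s⁻¹ hXi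
        simpa only [hX, h0, if_false, smul_smul, inv_mul_cancel₀ hs, one_smul, SetLike.mem_coe] using h
    · rintro _ ⟨j, ⟨hj1, hj3⟩, rfl⟩
      refine Submodule.subset_span ⟨Sum.inr ⟨j - 1, by omega⟩, ?_⟩
      simp [Nat.sub_add_cancel hj1]
  refine ⟨fun i _ => ?_, fun j hj _ => hB.y_mem j hj,
    linearIndependent_of_top_le_span_of_card_eq_finrank hspan.ge ?_, hspan⟩
  · by_cases h0 : i = 0
    · simpa [hX, h0] using hB.x_mem 0
    · simpa only [hX, h0, if_false] using Submodule.smul_mem _ s (hB.x_mem i)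
  · rw [← Submodule.finrank_add_eq_of_isCompl A.compl, hfil.2.1, hfil.2.2.1]
    simp

lemma not_evenPartIsQ5 (hB : A.IsGradedBasis x y)
    (h : ∀ i j, 1 ≤ i → 1 ≤ j → A.bk (x i) (x j) = 0) : ¬EvenPartIsQ5 A := by
  rintro ⟨Z, hZ, hli, -, hbk⟩
  have Z2 : Z 2 ∈ A.C 0 1 := by
    have h01 : A.bk (Z 0) (Z 1) = Z 2 := by simpa using hbk 0 1 (by omega) (by omega)
    exact h01 ▸ bk_mem_C (k := 0) (hZ 0 (by omega)) (hZ 1 (by omega))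
  have Z3 : Z 3 ∈ A.C 0 1 := by
    have h02 : A.bk (Z 0) (Z 2) = Z 3 := by simpa using hbk 0 2 (by omega) (by omega)
    exact h02 ▸ bk_mem_C (k := 0) (hZ 0 (by omega)) (hZ 2 (by omega))
  have h23 : A.bk (Z 2) (Z 3) = Z 5 := by simpa using hbk 2 3 (by omega) (by omega)
  refine hli.ne_zero 5 (h23.symm.trans (bk_eq_zero_of_mem_span ?_ (hB.C_one_le Z2)
    (hB.C_one_le Z3)))
  rintro _ ⟨i, ⟨hi, -⟩, rfl⟩ _ ⟨j, ⟨hj, -⟩, rfl⟩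
  exact h i j (by omega) (by omega)

end IsGradedBasis

lemma exists_isGradedBasis [FiniteDimensional ℂ V] (hfil : A.IsFiliform 5 3)
    (hng : A.NaturallyGraded) :
    ∃ x y, A.IsGradedBasis x y ∧ A.bk (x 1) (x 2) = 0 := by
  obtain ⟨W, -, h1, h2, h3⟩ := hng
  have hW : A.IsNaturalGrading W := ⟨h1, h2, h3⟩
  obtain ⟨q, p, r, hqp, hF, hF'⟩ := hW.exists_frame hfil
  obtain ⟨a, ha⟩ := (hF.isGradedBasis hW hfil).bk_xx 1 2 le_rfl (by omega)
  have ha : A.bk p (A.bk q p) = a • A.bk q (A.bk q p) := ha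
  have q_mem : q ∈ W 0 1 := hF.deg_one ▸ Submodule.subset_span (by simp)
  have p_mem : p ∈ W 0 1 := hF.deg_one ▸ Submodule.subset_span (by simp)
  have hq : A.bk q (p - a • q) = A.bk q p := by
    rw [map_sub, map_smul, bk_self (hW.le_g 0 0 q_mem), smul_zero, sub_zero]
  refine ⟨_, _, (hF' (p - a • q) (sub_mem p_mem (Submodule.smul_mem _ _ q_mem))
    (by rwa [hq])).isGradedBasis hW hfil, ?_⟩
  change A.bk (p - a • q) (A.bk q (p - a • q)) = 0
  rw [hq, map_sub, LinearMap.sub_apply, ha, map_smul, LinearMap.smul_apply, sub_self]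

end LieSuperAlg

/-- Every non-degenerate naturally graded filiform Lie superalgebra with
`dim g₀ = 6` and `dim g₁ = 3` is isomorphic to `L^{5,3} + φ̄₂₄`; in
particular its even part is never isomorphic to `Q₅`. -/
theorem stmt8 {V : Type*} [AddCommGroup V] [Module ℂ V] [FiniteDimensional ℂ V] (A : LieSuperAlg V)
    (hfil : A.IsFiliform 5 3) (hnd : A.NonDegenerate) (hng : A.NaturallyGraded) :
    (∃ X Y : ℕ → V, A.IsAdaptedBasis 5 3 X Y ∧
    (∀ i j : ℕ, i ≤ 5 → j ≤ 5 → A.bk (X i) (X j) =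
      if i = 0 ∧ 1 ≤ j ∧ j ≤ 4 then X (j + 1)
      else if j = 0 ∧ 1 ≤ i ∧ i ≤ 4 then -X (i + 1) else 0) ∧
    (∀ i j : ℕ, i ≤ 5 → 1 ≤ j → j ≤ 3 → A.bk (X i) (Y j) =
      if i = 0 ∧ j ≤ 2 then Y (j + 1) else 0) ∧
    (∀ i j : ℕ, 1 ≤ i → i ≤ 3 → 1 ≤ j → j ≤ 3 → A.bk (Y i) (Y j) =
      if i = 1 ∧ j = 1 then (3 : ℂ) • X 2
      else if (i = 1 ∧ j = 2) ∨ (i = 2 ∧ j = 1) then (3/2 : ℂ) • X 3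
      else if (i = 1 ∧ j = 3) ∨ (i = 3 ∧ j = 1) then (1/2 : ℂ) • X 4
      else if i = 2 ∧ j = 2 then X 4
      else if (i = 2 ∧ j = 3) ∨ (i = 3 ∧ j = 2) then (1/2 : ℂ) • X 5 else 0)) ∧
    ¬EvenPartIsQ5 A := by
  obtain ⟨x, y, hB, h12⟩ := LieSuperAlg.exists_isGradedBasis hfil hng
  obtain ⟨γ, hγ, h11, h12', h13, h22, h23, h33, hxx, hxy⟩ := hB.exists_products h12 hnd
  refine ⟨⟨fun i => if i = 0 then x 0 else (2 * γ) • x i, y,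
    hB.isAdaptedBasis hfil (mul_ne_zero two_ne_zero hγ), ?_, ?_, ?_⟩, hB.not_evenPartIsQ5 hxx⟩
  · have hx0 : ∀ i, 1 ≤ i → A.bk (x i) (x 0) = -x (i + 1) := fun i hi => by
      rw [LieSuperAlg.bk_even_swap (hB.x_mem i) (hB.x_mem 0), hB.ad_x i hi]
    have h00 := LieSuperAlg.bk_self (hB.x_mem 0)
    have h6 := hB.x_eq_zero 6 le_rfl
    intro i j hi hj
    rcases Nat.eq_zero_or_pos i with rfl | hi0 <;> rcases Nat.eq_zero_or_pos j with rfl | hj0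
    · simp [h00]
    · obtain rfl | hj4 : j = 5 ∨ j ≤ 4 := by omega
      · simp [hB.ad_x, h6]
      · simp [hB.ad_x j hj0, hj0.ne', Nat.one_le_iff_ne_zero, hj4]
    · obtain rfl | hi4 : i = 5 ∨ i ≤ 4 := by omega
      · simp [hx0, h6]
      · simp [hx0 i hi0, hi0.ne', Nat.one_le_iff_ne_zero, hi4]
    · simp [hi0.ne', hj0.ne', hxx i j hi0 hj0]
  · have h4 := hB.y_eq_zero 4 le_rfl
    intro i j hi hj1 hj3
    rcases Nat.eq_zero_or_pos i with rfl | hi0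
    · obtain rfl | hj2 : j = 3 ∨ j ≤ 2 := by omega
      · simp [hB.ad_y, h4]
      · simp [hB.ad_y j hj1, hj2]
    · simp [hi0.ne', hxy i j hi0 hj1]
  · have h21 := LieSuperAlg.bk_odd_swap (hB.y_mem 2 (by omega)) (hB.y_mem 1 (by omega))
    have h31 := LieSuperAlg.bk_odd_swap (hB.y_mem 3 (by omega)) (hB.y_mem 1 (by omega))
    have h32 := LieSuperAlg.bk_odd_swap (hB.y_mem 3 (by omega)) (hB.y_mem 2 (by omega))
    intro i j hi1 hi3 hj1 hj3
    interval_cases i <;> interval_cases j <;>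
      simp only [h11, h12', h13, h21, h22, h23, h31, h32, h33] <;> norm_num <;> module
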